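/- arXiv:2207.05540 — 2 statements merged into one kernel-verified Lean document; each statement's English description precedes it below -/
import Mathlib

section
/- (Schoenberg correspondence for *-bialgebras.) Let B be a *-bialgebra over ℂ with counit δ, and let ψ be a linear functional on B. Then the following are equivalent: (i) ψ is hermitian (ψ(b*) = conjugate of ψ(b) for all b ∈ B), conditionally positive (ψ(b* b) ≥ 0 for all b ∈ B with δ(b) = 0), and ψ(1) = 0; (ii) for every t ∈ ℝ with t ≥ 0, the convolution exponential exp_⋆(tψ), given by b ↦ Σ_{k=0}^∞ tᵏ ψ^{⋆k}(b)/k!, is a state on B, i.e. a positive ((exp_⋆(tψ))(b* b) ≥ 0 for all b) normalized ((exp_⋆(tψ))(1) = 1) linear functional. -/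
/-!
Schoenberg correspondence on a *-bialgebra: ψ is hermitian, conditionally positive and
vanishes at 1 iff exp_⋆(tψ) is a state for all t ≥ 0.
-/

open scoped TensorProduct ComplexOrder

noncomputable section

variable {B : Type*} [Ring B] [Bialgebra ℂ B] [StarRing B] [StarModule ℂ B]

/-- Convolution of linear functionals on the bialgebra: φ⋆ψ = (φ⊗ψ)∘Δ. -/
def conv (φ ψ : B →ₗ[ℂ] ℂ) : B →ₗ[ℂ] ℂ :=
  (TensorProduct.lid ℂ ℂ).toLinearMap ∘ₗ TensorProduct.map φ ψ ∘ₗ Coalgebra.comul (R := ℂ)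

/-- Convolution powers ψ^{⋆k}, with ψ^{⋆0} = δ (the counit). -/
def convPow (ψ : B →ₗ[ℂ] ℂ) : ℕ → (B →ₗ[ℂ] ℂ)
  | 0 => Coalgebra.counit (R := ℂ)
  | (k + 1) => conv (convPow ψ k) ψ

section Coalgebra

variable {K C : Type*} [Field K] [AddCommGroup C] [Module K C]

/-- The slice map `x ↦ (id ⊗ f) x` on `C ⊗ C`, as a linear map in `f`. -/
def sliceRight (x : C ⊗[K] C) : Module.Dual K C →ₗ[K] C :=
  (TensorProduct.rid K C).toLinearMap ∘ₗ LinearMap.applyₗ x ∘ₗ LinearMap.lTensorHom C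

@[simp]
lemma sliceRight_tmul (c d : C) (f : Module.Dual K C) :
    sliceRight (c ⊗ₜ[K] d) f = f d • c := by
  simp [sliceRight]

@[simp]
lemma sliceRight_zero : sliceRight (0 : C ⊗[K] C) = 0 := by
  ext; simp [sliceRight]

@[simp]
lemma sliceRight_add (x y : C ⊗[K] C) : sliceRight (x + y) = sliceRight x + sliceRight y := by
  ext; simp [sliceRight]

lemma sliceRight_injective : Function.Injective (sliceRight : C ⊗[K] C → _) := by
  classical
  intro x y h
  have 𝒞 := Module.Basis.ofVectorSpace K C
  apply (TensorProduct.equivFinsuppOfBasisRight (M := C) 𝒞).injective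
  ext i
  simpa [TensorProduct.equivFinsuppOfBasisRight_apply, sliceRight] using
    LinearMap.congr_fun h (𝒞.coord i)

lemma sliceRight_rTensor (p : C →ₗ[K] C) (x : C ⊗[K] C) (f : Module.Dual K C) :
    sliceRight (p.rTensor C x) f = p (sliceRight x f) := by
  induction x <;> simp_all

lemma exists_finiteDimensional_sliceRight_mem (x : C ⊗[K] C) :
    ∃ W : Submodule K C, FiniteDimensional K W ∧ ∀ f, sliceRight x f ∈ W := by
  induction x with
  | zero => exact ⟨⊥, inferInstance, by simp⟩
  | tmul c d =>
    refine ⟨K ∙ c, inferInstance, fun f => ?_⟩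
    rw [sliceRight_tmul]
    exact Submodule.smul_mem _ _ (Submodule.mem_span_singleton_self c)
  | add x y hx hy =>
    obtain ⟨W₁, _, h₁⟩ := hx
    obtain ⟨W₂, _, h₂⟩ := hy
    refine ⟨W₁ ⊔ W₂, inferInstance, fun f => ?_⟩
    rw [sliceRight_add]
    exact Submodule.add_mem_sup (h₁ f) (h₂ f)

variable [Coalgebra K C]

open Coalgebra

lemma sliceRight_comul_counit (c : C) : sliceRight (comul (R := K) c) counit = c := by
  simp [sliceRight]

lemma sliceRight_comul_sliceRight_comul (c : C) (f g : Module.Dual K C) :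
    sliceRight (comul (R := K) (sliceRight (comul (R := K) c) f)) g =
      sliceRight (comul (R := K) c) (LinearMap.mul' K K ∘ₗ TensorProduct.map g f ∘ₗ comul) := by
  have h₁ (x : C ⊗[K] C) : sliceRight (comul (R := K) (sliceRight x f)) g =
      TensorProduct.rid K C (TensorProduct.map LinearMap.id
        (LinearMap.mul' K K ∘ₗ TensorProduct.map g f)
        (TensorProduct.assoc K C C C (LinearMap.rTensor C comul x))) := by
    induction x with
    | zero => simp
    | tmul c d =>
      simp only [sliceRight_tmul, map_smul, LinearMap.rTensor_tmul]
      induction comul (R := K) c with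
      | zero => simp
      | tmul c c' => simp [smul_smul, mul_comm, sliceRight]
      | add x y hx hy => simp_all [TensorProduct.add_tmul, smul_add]
    | add x y hx hy => simp_all
  have h₂ (x : C ⊗[K] C) : sliceRight x (LinearMap.mul' K K ∘ₗ TensorProduct.map g f ∘ₗ comul) =
      TensorProduct.rid K C (TensorProduct.map LinearMap.id
        (LinearMap.mul' K K ∘ₗ TensorProduct.map g f)
        (LinearMap.lTensor C comul x)) := by
    induction x <;> simp_all
  rw [h₁, h₂, coassoc_apply]

lemma counit_lid_rTensor (q : Module.Dual K C) (x : C ⊗[K] C) :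
    counit (R := K) (TensorProduct.lid K C (q.rTensor C x)) = q (sliceRight x counit) := by
  induction x <;> simp_all [mul_comm]

/-- Every element of a coalgebra lies in a finite-dimensional right subcomodule; in coordinates,
the coaction on it is given by a matrix `a` of coefficients. -/
lemma exists_comul_eq_sum_tmul (c : C) :
    ∃ (n : ℕ) (e : Fin n → C) (a : Fin n → Fin n → C),
      (∀ i, comul (R := K) (e i) = ∑ j, e j ⊗ₜ[K] a j i) ∧
      (∀ i j, counit (R := K) (a i j) = if i = j then 1 else 0) ∧
      ∃ β : Fin n → K, c = ∑ i, β i • e i := by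
  classical
  let V : Submodule K C := LinearMap.range (sliceRight (comul (R := K) c))
  have : FiniteDimensional K V := by
    obtain ⟨W, _, hW⟩ := exists_finiteDimensional_sliceRight_mem (comul (R := K) c)
    exact Submodule.finiteDimensional_of_le (S₂ := W) (by rintro _ ⟨f, rfl⟩; exact hW f)
  have hcV : c ∈ V := ⟨counit, sliceRight_comul_counit c⟩
  have hinv : ∀ v ∈ V, ∀ g, sliceRight (comul (R := K) v) g ∈ V := by
    rintro _ ⟨f, rfl⟩ g
    rw [sliceRight_comul_sliceRight_comul]
    exact LinearMap.mem_range_self _ _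
  obtain ⟨p, hp⟩ := LinearMap.exists_extend (LinearMap.id : V →ₗ[K] V)
  have hp' (v : C) (hv : v ∈ V) : p v = ⟨v, hv⟩ := LinearMap.congr_fun hp ⟨v, hv⟩
  let 𝒷 := Module.finBasis K V
  have hsum (v : V) : (v : C) = ∑ j, 𝒷.coord j v • (𝒷 j : C) := by
    conv_lhs => rw [← 𝒷.sum_repr v]
    simp only [Submodule.coe_sum, Submodule.coe_smul, Module.Basis.coord_apply]
  let q (j : Fin (Module.finrank K V)) : Module.Dual K C := 𝒷.coord j ∘ₗ p
  let a (j i : Fin (Module.finrank K V)) : C :=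
    TensorProduct.lid K C ((q j).rTensor C (comul (R := K) (𝒷 i : C)))
  refine ⟨_, fun i => 𝒷 i, a, fun i => ?_, fun i j => ?_, fun i => 𝒷.coord i ⟨c, hcV⟩,
    hsum ⟨c, hcV⟩⟩
  · have h₁ (x : C ⊗[K] C) : (V.subtype ∘ₗ p).rTensor C x =
        ∑ j, (𝒷 j : C) ⊗ₜ[K] TensorProduct.lid K C ((q j).rTensor C x) := by
      induction x with
      | zero => simp
      | tmul c d =>
        simp only [LinearMap.rTensor_tmul, LinearMap.comp_apply, Submodule.subtype_apply,
          TensorProduct.lid_tmul, q]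
        rw [hsum (p c), TensorProduct.sum_tmul]
        simp [TensorProduct.smul_tmul]
      | add x y hx hy => simp [hx, hy, TensorProduct.tmul_add, Finset.sum_add_distrib]
    rw [← h₁]
    refine sliceRight_injective (LinearMap.ext fun f => ?_)
    rw [sliceRight_rTensor, LinearMap.comp_apply, hp' _ (hinv _ (𝒷 i).2 f)]
    rfl
  · simp only [a]
    rw [counit_lid_rTensor, sliceRight_comul_counit, LinearMap.comp_apply, hp' _ (𝒷 j).2]
    simp [Finsupp.single_apply, eq_comm]

end Coalgebra

section Exponential

variable {E : Type*} [NormedAddCommGroup E] [NormedSpace ℂ E] [CompleteSpace E]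

open NormedSpace

lemma hasSum_apply_exp_smul (A : E →L[ℂ] E) (x : E) (ℓ : E →L[ℂ] ℂ) (t : ℝ) :
    HasSum (fun k : ℕ => (((t ^ k : ℝ) : ℂ) / (k.factorial : ℂ)) * ℓ ((A ^ k) x))
      (ℓ (exp ((t : ℂ) • A) x)) := by
  have h := (exp_series_hasSum_exp' (𝕂 := ℂ) ((t : ℂ) • A)).mapL
    (ℓ ∘L ContinuousLinearMap.apply ℂ E x)
  convert! h using 2 with k
  simp [smul_pow, div_eq_inv_mul, mul_assoc]

lemma hasDerivAt_apply_exp_smul (A : E →L[ℂ] E) (x : E) (ℓ : E →L[ℂ] ℂ) :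
    HasDerivAt (fun t : ℝ => ℓ (exp ((t : ℂ) • A) x)) (ℓ (A x)) 0 := by
  have h := (hasDerivAt_exp_smul_const (𝕂 := ℂ) A 0)
  have h' := ((ℓ ∘L ContinuousLinearMap.apply ℂ E x).hasFDerivAt.comp_hasDerivAt _ h)
  have hreal := HasDerivAt.comp_ofReal (z := 0) (by simpa using h')
  simpa [Function.comp_def] using hreal

/-- If, for all `c > 0`, every power of `A + c⁻¹ • K + c • 1` is nonnegative on `x` with respect
to the functional `ℓ`, then so is `exp (t • A)` for `t ≥ 0`. -/
lemma apply_exp_smul_nonneg (A K : E →L[ℂ] E) (x : E) (ℓ : E →L[ℂ] ℂ)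
    (h : ∀ c : ℝ, 0 < c → ∀ k : ℕ, 0 ≤ ℓ (((A + (c : ℂ)⁻¹ • K + (c : ℂ) • 1) ^ k) x))
    {t : ℝ} (ht : 0 ≤ t) : 0 ≤ ℓ (exp ((t : ℂ) • A) x) := by
  let _ : NormedAlgebra ℚ (E →L[ℂ] E) := NormedAlgebra.restrictScalars ℚ ℂ _
  have hpos (c : ℝ) (hc : 0 < c) :
      0 ≤ ℓ (exp ((t : ℂ) • (A + (c : ℂ)⁻¹ • K)) x) := by
    have h₁ : 0 ≤ ℓ (exp ((t : ℂ) • (A + (c : ℂ)⁻¹ • K + (c : ℂ) • 1)) x) := by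
      refine (hasSum_apply_exp_smul _ x ℓ t).nonneg fun k => mul_nonneg ?_ (h c hc k)
      rw [← Complex.ofReal_natCast, ← Complex.ofReal_div, Complex.zero_le_real]
      positivity
    have h₂ : exp ((t : ℂ) • (A + (c : ℂ)⁻¹ • K)) =
        (Real.exp (-(t * c)) : ℂ) • exp ((t : ℂ) • (A + (c : ℂ)⁻¹ • K + (c : ℂ) • 1)) := by
      have h₃ : (t : ℂ) • (A + (c : ℂ)⁻¹ • K) =
          algebraMap ℂ (E →L[ℂ] E) ((-(t * c) : ℝ) : ℂ) +
            (t : ℂ) • (A + (c : ℂ)⁻¹ • K + (c : ℂ) • 1) := by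
        rw [Algebra.algebraMap_eq_smul_one, smul_add (t : ℂ) (_ + _), smul_smul]
        push_cast
        module
      rw [h₃, exp_add_of_commute (Algebra.commutes _ _), ← algebraMap_exp_comm,
        ← Complex.exp_eq_exp_ℂ, ← Complex.ofReal_exp, Algebra.algebraMap_eq_smul_one,
        smul_mul_assoc, one_mul]
    rw [h₂, smul_apply, map_smul, smul_eq_mul]
    exact mul_nonneg (Complex.zero_le_real.2 (Real.exp_pos _).le) h₁
  have hlim : Filter.Tendsto (fun c : ℝ => ℓ (exp ((t : ℂ) • (A + (c : ℂ)⁻¹ • K)) x))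
      Filter.atTop (nhds (ℓ (exp ((t : ℂ) • (A + (0 : ℂ) • K)) x))) := by
    have hinv : Filter.Tendsto (fun c : ℝ => (c : ℂ)⁻¹) Filter.atTop (nhds 0) := by
      simpa [Function.comp_def] using
        (Complex.continuous_ofReal.tendsto 0).comp tendsto_inv_atTop_zero
    have hcont : Continuous fun z : ℂ => ℓ (exp ((t : ℂ) • (A + z • K)) x) :=
      ℓ.continuous.comp ((ContinuousLinearMap.apply ℂ E x).continuous.comp
        (exp_continuous.comp (by fun_prop)))
    exact (hcont.tendsto 0).comp hinv
  rw [zero_smul, add_zero] at hlim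
  exact ge_of_tendsto hlim (Filter.eventually_atTop.2 ⟨1, fun c hc => hpos c (by linarith)⟩)

end Exponential

section GramMatrix

variable {M : Type*} [AddCommGroup M] [Module ℂ M] {n : ℕ}

/-- The Gram matrix of a family of vectors with respect to a sesquilinear form. -/
def sesqGram (G : M →ₗ⋆[ℂ] M →ₗ[ℂ] ℂ) (w : Fin n → M) : Fin n → Fin n → ℂ :=
  fun i j => G (w i) (w j)

/-- The action of a sesquilinear form on matrices through a matrix of vectors. -/
def sesqAct (a : Fin n → Fin n → M) (G : M →ₗ⋆[ℂ] M →ₗ[ℂ] ℂ) :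
    (Fin n → Fin n → ℂ) →L[ℂ] (Fin n → Fin n → ℂ) :=
  LinearMap.toContinuousLinearMap
    { toFun X i j := ∑ k, ∑ l, X k l * G (a k i) (a l j)
      map_add' X Y := by ext; simp [add_mul, Finset.sum_add_distrib]
      map_smul' z X := by ext; simp [mul_assoc, Finset.mul_sum] }

@[simp]
lemma sesqAct_apply (a : Fin n → Fin n → M) (G : M →ₗ⋆[ℂ] M →ₗ[ℂ] ℂ)
    (X : Fin n → Fin n → ℂ) (i j : Fin n) :
    sesqAct a G X i j = ∑ k, ∑ l, X k l * G (a k i) (a l j) := rfl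

lemma sesqAct_add (a : Fin n → Fin n → M) (G H : M →ₗ⋆[ℂ] M →ₗ[ℂ] ℂ) :
    sesqAct a (G + H) = sesqAct a G + sesqAct a H := by
  ext X i j
  simp [mul_add, Finset.sum_add_distrib]

lemma sesqAct_smul (a : Fin n → Fin n → M) (z : ℂ) (G : M →ₗ⋆[ℂ] M →ₗ[ℂ] ℂ) :
    sesqAct a (z • G) = z • sesqAct a G := by
  ext X i j
  simp [Finset.mul_sum, mul_left_comm]

/-- The functional `X ↦ ∑ i j, conj (β i) * β j * X i j`. -/
def quadEval (β : Fin n → ℂ) : (Fin n → Fin n → ℂ) →L[ℂ] ℂ :=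
  LinearMap.toContinuousLinearMap
    { toFun X := ∑ i, ∑ j, starRingEnd ℂ (β i) * β j * X i j
      map_add' X Y := by simp [mul_add, Finset.sum_add_distrib]
      map_smul' z X := by simp [Finset.mul_sum, mul_left_comm] }

@[simp]
lemma quadEval_apply (β : Fin n → ℂ) (X : Fin n → Fin n → ℂ) :
    quadEval β X = ∑ i, ∑ j, starRingEnd ℂ (β i) * β j * X i j := rfl

lemma quadEval_sesqGram (β : Fin n → ℂ) (G : M →ₗ⋆[ℂ] M →ₗ[ℂ] ℂ) (w : Fin n → M) :
    quadEval β (sesqGram G w) = G (∑ i, β i • w i) (∑ i, β i • w i) := by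
  simp only [quadEval_apply, sesqGram, map_sum, LinearMap.sum_apply, map_smulₛₗ,
    LinearMap.smul_apply, smul_eq_mul, Finset.mul_sum, mul_assoc, RingHom.id_apply]
  rw [Finset.sum_comm]
  exact Finset.sum_congr rfl fun i _ => Finset.sum_congr rfl fun j _ => by ring

lemma quadEval_eq_dotProduct (β : Fin n → ℂ) (X : Fin n → Fin n → ℂ) :
    quadEval β X = star β ⬝ᵥ (Matrix.of X).mulVec β := by
  simp only [quadEval_apply, dotProduct, Matrix.mulVec, Pi.star_apply, Matrix.of_apply,
    Finset.mul_sum, RCLike.star_def]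
  exact Finset.sum_congr rfl fun i _ => Finset.sum_congr rfl fun j _ => by ring

lemma posSemidef_sesqGram {G : M →ₗ⋆[ℂ] M →ₗ[ℂ] ℂ} (hG : G.IsPosSemidef) (w : Fin n → M) :
    (Matrix.of (sesqGram G w)).PosSemidef := by
  refine .of_dotProduct_mulVec_nonneg ?_ fun β => ?_
  · ext i j
    simpa [sesqGram] using hG.isSymm.eq (w j) (w i)
  · rw [← quadEval_eq_dotProduct, quadEval_sesqGram]
    exact hG.nonneg _

/-- A positive semidefinite form acts on matrices by a positive map. -/
lemma posSemidef_sesqAct {G : M →ₗ⋆[ℂ] M →ₗ[ℂ] ℂ} (hG : G.IsPosSemidef)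
    (a : Fin n → Fin n → M) {X : Fin n → Fin n → ℂ} (hX : (Matrix.of X).PosSemidef) :
    (Matrix.of (sesqAct a G X)).PosSemidef := by
  obtain ⟨m, v, hv⟩ := Matrix.posSemidef_iff_eq_sum_vecMulVec.1 hX
  have hX' (k l : Fin n) : X k l = ∑ r, v r k * starRingEnd ℂ (v r l) := by
    simpa [Matrix.sum_apply, Matrix.vecMulVec_apply] using congr_fun₂ hv k l
  have : Matrix.of (sesqAct a G X) =
      ∑ r, Matrix.of (sesqGram G fun i => ∑ k, starRingEnd ℂ (v r k) • a k i) := by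
    ext i j
    simp only [Matrix.of_apply, sesqAct_apply, hX', Matrix.sum_apply, sesqGram, map_sum,
      LinearMap.sum_apply, map_smulₛₗ, LinearMap.smul_apply, smul_eq_mul, Finset.sum_mul,
      Finset.mul_sum, Complex.conj_conj, RingHom.id_apply]
    rw [Finset.sum_congr rfl fun k _ => Finset.sum_comm, Finset.sum_comm]
    refine Finset.sum_congr rfl fun r _ => ?_
    rw [Finset.sum_comm]
    exact Finset.sum_congr rfl fun l _ => Finset.sum_congr rfl fun k _ => by ring
  rw [this]
  exact Matrix.posSemidef_sum _ fun r _ => posSemidef_sesqGram hG _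

lemma quadEval_sesqAct_pow_nonneg {G H : M →ₗ⋆[ℂ] M →ₗ[ℂ] ℂ} (hG : G.IsPosSemidef)
    (hH : H.IsPosSemidef) (a : Fin n → Fin n → M) (e : Fin n → M) (β : Fin n → ℂ) (k : ℕ) :
    0 ≤ quadEval β ((sesqAct a G ^ k) (sesqGram H e)) := by
  rw [quadEval_eq_dotProduct]
  refine Matrix.PosSemidef.dotProduct_mulVec_nonneg ?_ β
  induction k with
  | zero => exact posSemidef_sesqGram hH e
  | succ k ih =>
    rw [pow_succ']
    exact posSemidef_sesqAct hG a ih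

end GramMatrix

section Bialgebra

open Coalgebra

variable {H : Type*} [Ring H] [Bialgebra ℂ H]

/-- The sesquilinear form `(a, b) ↦ ψ (a* b)`. -/
def starForm (ψ : B →ₗ[ℂ] ℂ) : B →ₗ⋆[ℂ] B →ₗ[ℂ] ℂ :=
  LinearMap.mk₂'ₛₗ (starRingEnd ℂ) (RingHom.id ℂ) (fun a b => ψ (star a * b))
    (by simp [add_mul]) (by simp) (by simp [mul_add]) (by simp)

@[simp]
lemma starForm_apply (ψ : B →ₗ[ℂ] ℂ) (a b : B) : starForm ψ a b = ψ (star a * b) := rfl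

/-- The sesquilinear form `(a, b) ↦ conj (φ a) * φ b`. -/
def rankOneForm (φ : H →ₗ[ℂ] ℂ) : H →ₗ⋆[ℂ] H →ₗ[ℂ] ℂ :=
  LinearMap.mk₂'ₛₗ (starRingEnd ℂ) (RingHom.id ℂ) (fun a b => starRingEnd ℂ (φ a) * φ b)
    (by simp [add_mul]) (by simp [mul_assoc]) (by simp [mul_add]) (by simp [mul_left_comm])

@[simp]
lemma rankOneForm_apply (φ : H →ₗ[ℂ] ℂ) (a b : H) :
    rankOneForm φ a b = starRingEnd ℂ (φ a) * φ b := rfl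

lemma isPosSemidef_rankOneForm (φ : H →ₗ[ℂ] ℂ) : (rankOneForm φ).IsPosSemidef where
  eq a b := by simp [mul_comm]
  nonneg a := by
    rw [rankOneForm_apply, mul_comm, Complex.mul_conj]
    exact Complex.zero_le_real.2 (Complex.normSq_nonneg _)

/-- For a hermitian, conditionally positive `ψ` with `ψ 1 = 0`, the form `ψ (a* b)` becomes
positive semidefinite after adding suitable rank one forms. -/
lemma isPosSemidef_starForm_add
    {ψ : B →ₗ[ℂ] ℂ} (hherm : ∀ b : B, ψ (star b) = starRingEnd ℂ (ψ b))
    (hpos : ∀ b : B, counit (R := ℂ) b = 0 → 0 ≤ ψ (star b * b)) (hone : ψ 1 = 0)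
    {c : ℝ} (hc : 0 < c) :
    (starForm ψ + (c : ℂ)⁻¹ • rankOneForm ψ +
      (c : ℂ) • rankOneForm (counit (R := ℂ) (A := B))).IsPosSemidef where
  eq a b := by
    simp [← hherm, mul_comm]
  nonneg a := by
    set d : ℂ := counit (R := ℂ) a with hd
    have h₁ := hpos (a - d • 1) (by simp [hd])
    have h₂ : (starForm ψ + (c : ℂ)⁻¹ • rankOneForm ψ +
        (c : ℂ) • rankOneForm (counit (R := ℂ) (A := B))) a a =
        ψ (star (a - d • 1) * (a - d • 1)) +
          (c : ℂ)⁻¹ * ((c * d + ψ a) * starRingEnd ℂ (c * d + ψ a)) := by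
      have hc' : (c : ℂ) ≠ 0 := by exact_mod_cast hc.ne'
      simp [sub_mul, mul_sub, hone, hherm, ← hd]
      field_simp
      ring
    rw [h₂, Complex.mul_conj, ← Complex.ofReal_inv, ← Complex.ofReal_mul]
    refine add_nonneg h₁ (Complex.zero_le_real.2 ?_)
    have := Complex.normSq_nonneg (c * d + ψ a)
    positivity

lemma conv_apply_of_comul_eq {ι : Type*} {s : Finset ι} {x : H} {u v : ι → H}
    (h : comul (R := ℂ) x = ∑ i ∈ s, u i ⊗ₜ[ℂ] v i) (φ ψ : H →ₗ[ℂ] ℂ) :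
    conv φ ψ x = ∑ i ∈ s, φ (u i) * ψ (v i) := by
  simp [conv, h]

lemma convPow_one (ψ : H →ₗ[ℂ] ℂ) : convPow ψ 1 = ψ := by
  ext b
  change TensorProduct.lid ℂ ℂ (TensorProduct.map (counit (R := ℂ)) ψ (comul (R := ℂ) b)) = ψ b
  rw [← LinearMap.lTensor_comp_rTensor, LinearMap.comp_apply, rTensor_counit_comul]
  simp

lemma exists_hasSum_convPow (ψ : H →ₗ[ℂ] ℂ) (b : H) :
    ∃ F : ℝ → ℂ,
      (∀ t : ℝ, HasSum
        (fun k : ℕ => (((t ^ k : ℝ) : ℂ) / (k.factorial : ℂ)) * convPow ψ k b) (F t)) ∧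
      F 0 = counit (R := ℂ) b ∧ HasDerivAt F (ψ b) 0 := by
  obtain ⟨n, e, a, he, -, β, rfl⟩ := exists_comul_eq_sum_tmul (K := ℂ) b
  let A : (Fin n → ℂ) →L[ℂ] (Fin n → ℂ) := LinearMap.toContinuousLinearMap
    { toFun x i := ∑ j, x j * ψ (a j i)
      map_add' x y := by ext; simp [add_mul, Finset.sum_add_distrib]
      map_smul' z x := by ext; simp [mul_assoc, Finset.mul_sum] }
  let ℓ : (Fin n → ℂ) →L[ℂ] ℂ := LinearMap.toContinuousLinearMap
    { toFun x := ∑ i, β i * x i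
      map_add' x y := by simp [mul_add, Finset.sum_add_distrib]
      map_smul' z x := by simp [mul_left_comm, Finset.mul_sum] }
  let x₀ : Fin n → ℂ := fun i => counit (R := ℂ) (e i)
  have hA (k : ℕ) : (A ^ k) x₀ = fun i => convPow ψ k (e i) := by
    induction k with
    | zero => rfl
    | succ k ih =>
      rw [pow_succ', mul_apply_eq_comp, ih]
      ext i
      exact (conv_apply_of_comul_eq (he i) _ _).symm
  have hℓ (k : ℕ) : ℓ ((A ^ k) x₀) = convPow ψ k (∑ i, β i • e i) := by
    rw [hA]
    simp [ℓ]
  refine ⟨fun t => ℓ (NormedSpace.exp ((t : ℂ) • A) x₀), fun t => ?_, ?_, ?_⟩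
  · simpa only [hℓ] using hasSum_apply_exp_smul A x₀ ℓ t
  · have h : NormedSpace.exp (((0 : ℝ) : ℂ) • A) = 1 := by
      rw [Complex.ofReal_zero, zero_smul ℂ A, NormedSpace.exp_zero]
    change ℓ (NormedSpace.exp (((0 : ℝ) : ℂ) • A) x₀) = _
    rw [h]
    exact hℓ 0
  · have h := hasDerivAt_apply_exp_smul A x₀ ℓ
    rwa [← pow_one A, hℓ 1, convPow_one, pow_one] at h

lemma sesqGram_starForm_conv {n : ℕ} {e : Fin n → B} {a : Fin n → Fin n → B}
    (hΔ : ∀ (b : B) (n : ℕ) (b₁ b₂ : Fin n → B),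
      comul (R := ℂ) b = ∑ i, b₁ i ⊗ₜ[ℂ] b₂ i →
      comul (R := ℂ) (star b) = ∑ i, star (b₁ i) ⊗ₜ[ℂ] star (b₂ i))
    (he : ∀ i, comul (R := ℂ) (e i) = ∑ j, e j ⊗ₜ[ℂ] a j i) (φ ψ : B →ₗ[ℂ] ℂ) :
    sesqGram (starForm (conv φ ψ)) e = sesqAct a (starForm ψ) (sesqGram (starForm φ) e) := by
  ext i j
  have h : comul (R := ℂ) (star (e i) * e j) =
      ∑ p : Fin n × Fin n, (star (e p.1) * e p.2) ⊗ₜ[ℂ] (star (a p.1 i) * a p.2 j) := by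
    rw [Bialgebra.comul_mul, hΔ _ _ _ _ (he i), he j, Finset.sum_mul_sum, Fintype.sum_prod_type]
    simp
  simp [sesqGram, conv_apply_of_comul_eq h, Fintype.sum_prod_type]

lemma sesqAct_rankOneForm_counit {n : ℕ} {a : Fin n → Fin n → H}
    (ha : ∀ i j, counit (R := ℂ) (a i j) = if i = j then 1 else 0) :
    sesqAct a (rankOneForm (counit (R := ℂ) (A := H))) = 1 := by
  ext X i j
  simp [ha]

lemma starForm_counit
    (hδ : ∀ b : B, counit (R := ℂ) (star b) = starRingEnd ℂ (counit (R := ℂ) b)) :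
    starForm (counit (R := ℂ) (A := B)) = rankOneForm (counit (R := ℂ)) := by
  ext x y
  simp [hδ]

lemma convExp_star_mul_self_nonneg
    (hΔ : ∀ (b : B) (n : ℕ) (b₁ b₂ : Fin n → B),
      comul (R := ℂ) b = ∑ i, b₁ i ⊗ₜ[ℂ] b₂ i →
      comul (R := ℂ) (star b) = ∑ i, star (b₁ i) ⊗ₜ[ℂ] star (b₂ i))
    (hδ : ∀ b : B, counit (R := ℂ) (star b) = starRingEnd ℂ (counit (R := ℂ) b))
    {ψ : B →ₗ[ℂ] ℂ} (hherm : ∀ b : B, ψ (star b) = starRingEnd ℂ (ψ b))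
    (hpos : ∀ b : B, counit (R := ℂ) b = 0 → 0 ≤ ψ (star b * b)) (hone : ψ 1 = 0)
    {t : ℝ} (ht : 0 ≤ t) {b : B} {s : ℂ}
    (hs : HasSum (fun k : ℕ => (((t ^ k : ℝ) : ℂ) / (k.factorial : ℂ)) *
      convPow ψ k (star b * b)) s) : 0 ≤ s := by
  obtain ⟨n, e, a, he, ha, β, rfl⟩ := exists_comul_eq_sum_tmul (K := ℂ) b
  set X₀ := sesqGram (rankOneForm (counit (R := ℂ) (A := B))) e with hX₀
  have hX (k : ℕ) : (sesqAct a (starForm ψ) ^ k) X₀ = sesqGram (starForm (convPow ψ k)) e := by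
    induction k with
    | zero => rw [hX₀, ← starForm_counit hδ]; rfl
    | succ k ih =>
      rw [pow_succ', mul_apply_eq_comp, ih]
      exact (sesqGram_starForm_conv hΔ he _ _).symm
  have hsum := hasSum_apply_exp_smul (sesqAct a (starForm ψ)) X₀ (quadEval β) t
  simp only [hX, quadEval_sesqGram, starForm_apply] at hsum
  rw [hs.unique hsum]
  refine apply_exp_smul_nonneg _ (sesqAct a (rankOneForm ψ)) _ _ (fun c hc k => ?_) ht
  rw [← sesqAct_rankOneForm_counit ha, ← sesqAct_smul, ← sesqAct_smul, ← sesqAct_add,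
    ← sesqAct_add]
  exact quadEval_sesqAct_pow_nonneg (isPosSemidef_starForm_add hherm hpos hone hc)
    (isPosSemidef_rankOneForm _) a e β k

lemma convPow_succ_one {ψ : H →ₗ[ℂ] ℂ} (hone : ψ 1 = 0) (k : ℕ) : convPow ψ (k + 1) 1 = 0 := by
  simp [convPow, conv, hone, Algebra.TensorProduct.one_def]

/-- A functional that is real on all elements `b* b` is hermitian. -/
lemma map_star_of_im_eq_zero {ψ : B →ₗ[ℂ] ℂ} (h : ∀ b : B, (ψ (star b * b)).im = 0) (b : B) :
    ψ (star b) = starRingEnd ℂ (ψ b) := by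
  have h₀ := h 1
  have h₁ := h b
  have h₂ := h (1 + b)
  have h₃ := h (1 + Complex.I • b)
  simp [add_mul, mul_add] at h₀ h₁ h₂ h₃
  apply Complex.ext
  · simp
    linarith
  · simp
    linarith

end Bialgebra

/-- **Schoenberg correspondence for *-bialgebras.**  Let B be a *-bialgebra (a bialgebra
with a *-algebra structure such that Δ and δ are *-homomorphisms; the compatibility of
Δ and δ with the involution is expressed by the hypotheses `hΔstar` and `hδstar`), and
let ψ be a linear functional on B.  The following are equivalent:
(i) ψ is hermitian, conditionally positive and ψ(1) = 0;
(ii) for every t ≥ 0 the convolution exponential exp_⋆(tψ), b ↦ Σ_k tᵏψ^{⋆k}(b)/k!, is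
a state on B (normalized and positive). -/
theorem schoenberg_correspondence_star_bialgebra
    (hΔstar : ∀ (b : B) (n : ℕ) (b₁ b₂ : Fin n → B),
      Coalgebra.comul (R := ℂ) b = ∑ i, b₁ i ⊗ₜ[ℂ] b₂ i →
      Coalgebra.comul (R := ℂ) (star b) = ∑ i, star (b₁ i) ⊗ₜ[ℂ] star (b₂ i))
    (hδstar : ∀ b : B,
      Coalgebra.counit (R := ℂ) (star b) = (starRingEnd ℂ) (Coalgebra.counit (R := ℂ) b))
    (ψ : B →ₗ[ℂ] ℂ) :
    ((∀ b : B, ψ (star b) = (starRingEnd ℂ) (ψ b)) ∧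
      (∀ b : B, Coalgebra.counit (R := ℂ) b = 0 → 0 ≤ ψ (star b * b)) ∧
      ψ 1 = 0)
    ↔
    (∀ t : ℝ, 0 ≤ t → ∃ Φ : B → ℂ,
      (∀ b : B, HasSum
        (fun k : ℕ => (((t ^ k : ℝ) : ℂ) / (k.factorial : ℂ)) * convPow ψ k b) (Φ b)) ∧
      Φ 1 = 1 ∧ ∀ b : B, 0 ≤ Φ (star b * b)) := by
  constructor
  · rintro ⟨hherm, hpos, hone⟩ t ht
    choose F hF _ _ using exists_hasSum_convPow ψ
    refine ⟨fun b => F b t, fun b => hF b t, (hF 1 t).unique ?_, fun b =>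
      convExp_star_mul_self_nonneg hΔstar hδstar hherm hpos hone ht (hF (star b * b) t)⟩
    convert! hasSum_single 0 fun k hk => ?_
    · simp [convPow]
    · obtain ⟨k, rfl⟩ := Nat.exists_eq_succ_of_ne_zero hk
      simp [convPow_succ_one hone]
  · intro h
    choose F hF hF₀ hF' using exists_hasSum_convPow ψ
    have hF₁ (t : ℝ) (ht : 0 ≤ t) : F 1 t = 1 := by
      obtain ⟨Φ, hΦ, hΦ₁, -⟩ := h t ht
      rw [(hF 1 t).unique (hΦ 1), hΦ₁]
    have hFpos (t : ℝ) (ht : 0 ≤ t) (b : B) : 0 ≤ F (star b * b) t := by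
      obtain ⟨Φ, hΦ, -, hΦ'⟩ := h t ht
      rw [(hF _ t).unique (hΦ _)]
      exact hΦ' b
    have hlim (b : B) : Filter.Tendsto
        (fun t : ℝ => t⁻¹ • (F b t - Coalgebra.counit (R := ℂ) b))
        (nhdsWithin 0 (Set.Ioi 0)) (nhds (ψ b)) := by
      simpa [hF₀] using (hF' b).tendsto_slope_zero_right
    have hreal (b : B) : (ψ (star b * b)).im = 0 := by
      refine tendsto_nhds_unique ((Complex.continuous_im.tendsto _).comp (hlim (star b * b))) ?_
      refine tendsto_const_nhds.congr' ?_
      filter_upwards [self_mem_nhdsWithin] with t ht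
      have := (Complex.nonneg_iff.1 (hFpos t (le_of_lt ht) b)).2
      simp [← this, hδstar, mul_comm]
    refine ⟨map_star_of_im_eq_zero hreal, fun b hb => ?_, ?_⟩
    · refine ge_of_tendsto (hlim (star b * b)) ?_
      filter_upwards [self_mem_nhdsWithin] with t ht
      have ht' : (0 : ℝ) ≤ t := le_of_lt ht
      simpa [hb] using mul_nonneg (Complex.zero_le_real.2 (inv_nonneg.2 ht')) (hFpos t ht' b)
    · refine tendsto_nhds_unique (hlim 1) (tendsto_const_nhds.congr' ?_)
      filter_upwards [self_mem_nhdsWithin] with t ht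
      simp [hF₁ t (le_of_lt ht)]

end
end

section
/- Let B be a *-bialgebra over ℂ with counit δ and let (φ_t)_{t ≥ 0} be a weakly continuous convolution semigroup of states on B, i.e. each φ_t is a state, φ_{s+t} = φ_s ⋆ φ_t for all s, t ≥ 0, φ_0 = δ, and φ_t(b) → δ(b) as t ↓ 0 for every b ∈ B. Then for every b ∈ B the limit ψ(b) := lim_{t↓0} (φ_t(b) − δ(b))/t exists; the resulting linear functional ψ is hermitian and conditionally positive with ψ(1) = 0; and φ_t = exp_⋆(tψ) for all t ≥ 0, i.e. φ_t(b) = Σ_{k=0}^∞ tᵏ ψ^{⋆k}(b)/k! for all b ∈ B. -/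
/-!
Generators of convolution semigroups of states on a *-bialgebra: every weakly
continuous convolution semigroup (φ_t) of states has a generator ψ, which is hermitian,
conditionally positive with ψ(1) = 0, and φ_t = exp_⋆(tψ).
-/

open scoped TensorProduct ComplexOrder

noncomputable section

variable {B : Type*} [Ring B] [Bialgebra ℂ B] [StarRing B] [StarModule ℂ B]

section NormedAlgebraSemigroup

open Filter Topology Set

variable {A : Type*} [NormedRing A] [CompleteSpace A] {T : ℝ → A}

/-- A one-parameter semigroup in a Banach algebra that is norm continuous at `0` is norm
continuous on `[0, ∞)`. -/
theorem continuousOn_of_semigroup (hT0 : T 0 = 1)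
    (hTadd : ∀ s t, 0 ≤ s → 0 ≤ t → T (s + t) = T s * T t)
    (hT : Tendsto T (𝓝[>] 0) (𝓝 1)) : ContinuousOn T (Ici 0) := by
  have habs : Tendsto (fun h : ℝ => T |h|) (𝓝 0) (𝓝 1) := by
    have h1 : Tendsto T (𝓝[≥] 0) (𝓝 1) := by
      rw [← Ioi_insert, nhdsWithin_insert]
      exact Tendsto.sup (by simpa [hT0] using tendsto_pure_nhds T (0 : ℝ)) hT
    refine h1.comp (tendsto_nhdsWithin_iff.2 ⟨?_, Eventually.of_forall fun h => abs_nonneg h⟩)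
    simpa using (continuous_abs.tendsto (0 : ℝ))
  intro t ht
  have hsub : Tendsto (fun s : ℝ => s - t) (𝓝[Ici 0] t) (𝓝 0) := by
    have : Tendsto (fun s : ℝ => s - t) (𝓝 t) (𝓝 (t - t)) :=
      (continuous_id.sub continuous_const).tendsto t
    rw [sub_self] at this
    exact this.mono_left inf_le_left
  have hg : Tendsto (fun s : ℝ => T |s - t|) (𝓝[Ici 0] t) (𝓝 1) := habs.comp hsub
  have hinv : Tendsto (fun s : ℝ => Ring.inverse (T |s - t|)) (𝓝[Ici 0] t) (𝓝 1) := by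
    have := (NormedRing.inverse_continuousAt (1 : Aˣ)).tendsto
    simp only [Units.val_one, Ring.inverse_one] at this
    exact this.comp hg
  have hunit : ∀ᶠ s in 𝓝[Ici 0] t, IsUnit (T |s - t|) :=
    hg.eventually (Units.isOpen.mem_nhds isUnit_one)
  have hlim : Tendsto (fun s : ℝ => if t ≤ s then T t * T |s - t| else
      T t * Ring.inverse (T |s - t|)) (𝓝[Ici 0] t) (𝓝 (T t)) := by
    refine Tendsto.if' ?_ ?_
    · simpa using hg.const_mul (T t)
    · simpa using hinv.const_mul (T t)
  refine hlim.congr' ?_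
  filter_upwards [hunit, self_mem_nhdsWithin] with s hs hs0
  split_ifs with hts
  · rw [← hTadd _ _ ht (abs_nonneg _), abs_of_nonneg (sub_nonneg.2 hts)]
    congr 1
    ring
  · have : T t = T s * T |s - t| := by
      rw [← hTadd _ _ hs0 (abs_nonneg _), abs_of_nonpos (by linarith)]
      congr 1
      ring
    rw [this, mul_assoc, Ring.mul_inverse_cancel _ hs, mul_one]

/-- A one-parameter semigroup in a Banach algebra that is norm continuous at `0` is
right differentiable, with derivative `T t * X` for a fixed element `X`. -/
theorem exists_hasDerivWithinAt_of_semigroup [NormedAlgebra ℝ A] (hT0 : T 0 = 1)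
    (hTadd : ∀ s t, 0 ≤ s → 0 ≤ t → T (s + t) = T s * T t)
    (hT : Tendsto T (𝓝[>] 0) (𝓝 1)) :
    ∃ X : A, ∀ t, 0 ≤ t → HasDerivWithinAt T (T t * X) (Ici t) t := by
  have hcont := continuousOn_of_semigroup hT0 hTadd hT
  let S : ℝ → A := fun t => T (max t 0)
  have hS : Continuous S := hcont.comp_continuous (by fun_prop) fun t => mem_Ici.2 (le_max_right t 0)
  have hST : ∀ t, 0 ≤ t → S t = T t := fun t ht => by simp only [S, max_eq_left ht]
  let F : ℝ → A := fun t => ∫ s in (0 : ℝ)..t, S s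
  have hF : ∀ t, HasDerivAt F (S t) t := fun t => hS.integral_hasStrictDerivAt 0 t |>.hasDerivAt
  obtain ⟨a, ha, u, hu⟩ : ∃ a : ℝ, 0 < a ∧ IsUnit (F a) := by
    have h0 := (hF 0).tendsto_slope_zero_right
    rw [hST 0 le_rfl, hT0] at h0
    obtain ⟨a, hau, ha⟩ := ((h0.eventually (Units.isOpen.mem_nhds isUnit_one)).and
      self_mem_nhdsWithin).exists
    have ha : 0 < a := ha
    refine ⟨a, ha, ?_⟩
    have hF0 : F 0 = 0 := intervalIntegral.integral_same
    have hau : IsUnit (a⁻¹ • F a) := by simpa [hF0] using hau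
    have := (IsUnit.smul (Units.mk0 a ha.ne') hau)
    rwa [Units.smul_mk0, smul_inv_smul₀ ha.ne'] at this
  have hmul : ∀ t, 0 ≤ t → T t * F a = F (t + a) - F t := by
    intro t ht
    have h1 : T t * F a = ∫ s in (0 : ℝ)..a, T t * S s :=
      ((ContinuousLinearMap.mul ℝ A (T t)).intervalIntegral_comp_comm
        (hS.intervalIntegrable 0 a)).symm
    have h2 : ∫ s in (0 : ℝ)..a, T t * S s = ∫ s in (0 : ℝ)..a, S (t + s) := by
      refine intervalIntegral.integral_congr fun s hs => ?_
      rw [uIcc_of_le ha.le] at hs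
      simp only [hST _ hs.1, hST _ (add_nonneg ht hs.1), hTadd t s ht hs.1]
    rw [h1, h2, intervalIntegral.integral_comp_add_left S t, add_zero, eq_sub_iff_add_eq, add_comm]
    exact intervalIntegral.integral_add_adjacent_intervals
      (hS.intervalIntegrable _ _) (hS.intervalIntegrable _ _)
  have heq : ∀ t, 0 ≤ t → T t = (F (t + a) - F t) * ↑u⁻¹ := fun t ht => by
    rw [← hmul t ht, ← hu, mul_assoc, Units.mul_inv, mul_one]
  refine ⟨(T a - 1) * ↑u⁻¹, fun t ht => ?_⟩
  have hd : HasDerivAt (fun t => (F (t + a) - F t) * (↑u⁻¹ : A))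
      ((S (t + a) - S t) * ↑u⁻¹) t :=
    (((hF (t + a)).comp_add_const t a).sub (hF t)).mul_const _
  have hval : (S (t + a) - S t) * (↑u⁻¹ : A) = T t * ((T a - 1) * ↑u⁻¹) := by
    rw [hST _ (by positivity), hST _ ht, hTadd _ _ ht ha.le, ← mul_assoc, mul_sub, mul_one]
  rw [← hval]
  exact hd.hasDerivWithinAt.congr (fun s hs => heq s (ht.trans hs)) (heq t ht)

/-- A one-parameter semigroup in a Banach algebra that is norm continuous at `0` is
of the form `t ↦ exp (t • X)`. -/
theorem exists_eq_exp_smul_of_semigroup [NormedAlgebra ℝ A] (hT0 : T 0 = 1)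
    (hTadd : ∀ s t, 0 ≤ s → 0 ≤ t → T (s + t) = T s * T t)
    (hT : Tendsto T (𝓝[>] 0) (𝓝 1)) :
    ∃ X : A, ∀ t, 0 ≤ t → T t = NormedSpace.exp (t • X) := by
  obtain ⟨X, hX⟩ := exists_hasDerivWithinAt_of_semigroup hT0 hTadd hT
  have hcont := continuousOn_of_semigroup hT0 hTadd hT
  refine ⟨X, fun t ht => ?_⟩
  have hE : ∀ s : ℝ, HasDerivAt (fun r : ℝ => NormedSpace.exp (r • (-X)))
      (-X * NormedSpace.exp (s • (-X))) s := fun s => hasDerivAt_exp_smul_const' (-X) s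
  have hconst := constant_of_has_deriv_right_zero (a := 0) (b := t)
    (f := fun s => T s * NormedSpace.exp (s • (-X)))
    ((hcont.mono Icc_subset_Ici_self).mul fun s _ => (hE s).continuousAt.continuousWithinAt)
    (fun s hs => by
      have := (hX s hs.1).mul (hE s).hasDerivWithinAt
      rwa [neg_mul, mul_neg, mul_assoc, add_neg_cancel] at this)
    t ⟨ht, le_rfl⟩
  simp only [hT0, zero_smul, NormedSpace.exp_zero, mul_one] at hconst
  let _ : NormedAlgebra ℚ A := NormedAlgebra.restrictScalars ℚ ℝ A
  have hinv : NormedSpace.exp (t • (-X)) * NormedSpace.exp (t • X) = 1 := by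
    rw [smul_neg, ← NormedSpace.exp_add_of_commute ((Commute.refl (t • X)).neg_left),
      neg_add_cancel, NormedSpace.exp_zero]
  rw [← mul_one (T t), ← hinv, ← mul_assoc, hconst, one_mul]

end NormedAlgebraSemigroup

section MatrixCoefficients

variable {H : Type*} [Ring H] [Bialgebra ℂ H]

/-- The right convolution operator `b ↦ b₍₁₎ φ(b₍₂₎)` of a linear functional. -/
def convOperator (φ : H →ₗ[ℂ] ℂ) : H →ₗ[ℂ] H :=
  (TensorProduct.rid ℂ H).toLinearMap ∘ₗ φ.lTensor H ∘ₗ Coalgebra.comul (R := ℂ)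

theorem convOperator_apply (φ : H →ₗ[ℂ] ℂ) (b : H) :
    convOperator φ b = TensorProduct.rid ℂ H (φ.lTensor H (Coalgebra.comul (R := ℂ) b)) := rfl

theorem convOperator_counit :
    convOperator (Coalgebra.counit (R := ℂ) : H →ₗ[ℂ] ℂ) = LinearMap.id := by
  ext b
  simp [convOperator_apply]

theorem apply_convOperator (χ φ : H →ₗ[ℂ] ℂ) (b : H) : χ (convOperator φ b) = conv χ φ b := by
  have key : χ ∘ₗ (TensorProduct.rid ℂ H).toLinearMap ∘ₗ φ.lTensor H =
      (TensorProduct.lid ℂ ℂ).toLinearMap ∘ₗ TensorProduct.map χ φ := by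
    ext x y
    simp [mul_comm]
  exact LinearMap.congr_fun key (Coalgebra.comul (R := ℂ) b)

theorem conv_eq_lTensor (χ φ : H →ₗ[ℂ] ℂ) (b : H) :
    conv χ φ b = φ (TensorProduct.lid ℂ H (χ.rTensor H (Coalgebra.comul (R := ℂ) b))) := by
  have key : φ ∘ₗ (TensorProduct.lid ℂ H).toLinearMap ∘ₗ χ.rTensor H =
      (TensorProduct.lid ℂ ℂ).toLinearMap ∘ₗ TensorProduct.map χ φ := by
    ext x y
    simp
  exact (LinearMap.congr_fun key (Coalgebra.comul (R := ℂ) b)).symm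

theorem counit_convOperator (φ : H →ₗ[ℂ] ℂ) (b : H) :
    Coalgebra.counit (R := ℂ) (convOperator φ b) = φ b := by
  rw [apply_convOperator, conv_eq_lTensor]
  simp

theorem convOperator_conv (φ ψ : H →ₗ[ℂ] ℂ) :
    convOperator (conv φ ψ) = convOperator φ ∘ₗ convOperator ψ := by
  have key : convOperator φ ∘ₗ (TensorProduct.rid ℂ H).toLinearMap ∘ₗ ψ.lTensor H =
      (TensorProduct.rid ℂ H).toLinearMap ∘ₗ
        ((TensorProduct.lid ℂ ℂ).toLinearMap ∘ₗ TensorProduct.map φ ψ).lTensor H ∘ₗ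
        (TensorProduct.assoc ℂ H H H).toLinearMap ∘ₗ
        (Coalgebra.comul (R := ℂ)).rTensor H := by
    ext x y
    have h : ψ y • ((TensorProduct.rid ℂ H).toLinearMap ∘ₗ φ.lTensor H) =
        (TensorProduct.rid ℂ H).toLinearMap ∘ₗ
        ((TensorProduct.lid ℂ ℂ).toLinearMap ∘ₗ TensorProduct.map φ ψ).lTensor H ∘ₗ
        (TensorProduct.assoc ℂ H H H).toLinearMap ∘ₗ (TensorProduct.mk ℂ (H ⊗[ℂ] H) H).flip y := by
      ext p q
      simp [smul_smul, mul_comm]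
    simpa [convOperator_apply] using LinearMap.congr_fun h (Coalgebra.comul (R := ℂ) x)
  ext b
  have hb := LinearMap.congr_fun key (Coalgebra.comul (R := ℂ) b)
  simp only [LinearMap.comp_apply, LinearEquiv.coe_coe, Coalgebra.coassoc_apply] at hb
  rw [LinearMap.comp_apply, convOperator_apply ψ, hb, convOperator_apply, conv,
    ← LinearMap.comp_assoc, LinearMap.lTensor_comp _ _ (Coalgebra.comul (R := ℂ))]
  rfl

/-- The convolution operators generate, from a single element, a finite-dimensional subspace
containing that element and invariant under all convolution operators. -/
theorem exists_finiteDimensional_invariant (b : H) :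
    ∃ V : Submodule ℂ H, FiniteDimensional ℂ V ∧ b ∈ V ∧
      ∀ (φ : H →ₗ[ℂ] ℂ), ∀ x ∈ V, convOperator φ x ∈ V := by
  let 𝓡 := Coalgebra.Repr.arbitrary ℂ b
  let orbit : (H →ₗ[ℂ] ℂ) →ₗ[ℂ] H :=
    ∑ i ∈ 𝓡.index, (LinearMap.toSpanSingleton ℂ H (𝓡.left i)) ∘ₗ LinearMap.applyₗ (𝓡.right i)
  have horbit : ∀ φ, orbit φ = convOperator φ b := fun φ => by
    simp [orbit, convOperator_apply, ← 𝓡.eq]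
  refine ⟨LinearMap.range orbit, ?_, ⟨Coalgebra.counit, ?_⟩, ?_⟩
  · have hle : LinearMap.range orbit ≤ Submodule.span ℂ (𝓡.left '' 𝓡.index) := by
      rintro _ ⟨φ, rfl⟩
      simp only [orbit, LinearMap.sum_apply]
      refine Submodule.sum_mem _ fun i hi => Submodule.smul_mem _ _
        (Submodule.subset_span ⟨i, hi, rfl⟩)
    have : FiniteDimensional ℂ (Submodule.span ℂ (𝓡.left '' 𝓡.index)) :=
      FiniteDimensional.span_of_finite ℂ (𝓡.index.finite_toSet.image _)
    exact Submodule.finiteDimensional_of_le hle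
  · rw [horbit, convOperator_counit, LinearMap.id_apply]
  · rintro φ _ ⟨χ, rfl⟩
    exact ⟨conv φ χ, by rw [horbit, horbit, convOperator_conv, LinearMap.comp_apply]⟩

/-- Every element of a bialgebra is a linear combination of the entries of a matrix
corepresentation `d`: evaluating functionals entrywise on `d` turns convolution into matrix
multiplication. -/
theorem exists_matrix_corepresentation (b : H) :
    ∃ (n : ℕ) (d : Matrix (Fin n) (Fin n) H) (f : Matrix (Fin n) (Fin n) ℂ →ₗ[ℂ] ℂ),
      (∀ φ : H →ₗ[ℂ] ℂ, φ b = f (d.map φ)) ∧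
      (∀ φ ψ : H →ₗ[ℂ] ℂ, d.map (conv φ ψ) = d.map φ * d.map ψ) ∧
      d.map (Coalgebra.counit (R := ℂ) : H →ₗ[ℂ] ℂ) = 1 := by
  obtain ⟨V, hfin, hbV, hV⟩ := exists_finiteDimensional_invariant b
  let e := Module.finBasis ℂ V
  let L : (H →ₗ[ℂ] ℂ) → Module.End ℂ V := fun φ => (convOperator φ).restrict (hV φ)
  choose ℓ hℓ using fun i => (e.coord i).exists_extend
  let d : Matrix (Fin (Module.finrank ℂ V)) (Fin (Module.finrank ℂ V)) H := fun i j =>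
    TensorProduct.lid ℂ H ((ℓ i).rTensor H (Coalgebra.comul (R := ℂ) (e j : H)))
  have hd : ∀ φ : H →ₗ[ℂ] ℂ, d.map φ = LinearMap.toMatrix e e (L φ) := by
    intro φ
    ext i j
    rw [LinearMap.toMatrix_apply, Matrix.map_apply]
    simp only [d]
    rw [← conv_eq_lTensor, ← apply_convOperator]
    exact LinearMap.congr_fun (hℓ i) (L φ (e j))
  let f : Matrix (Fin (Module.finrank ℂ V)) (Fin (Module.finrank ℂ V)) ℂ →ₗ[ℂ] ℂ :=
    (Coalgebra.counit (R := ℂ) ∘ₗ V.subtype) ∘ₗ LinearMap.applyₗ (⟨b, hbV⟩ : V) ∘ₗ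
      (Matrix.toLin e e).toLinearMap
  refine ⟨_, d, f, ?_, ?_, ?_⟩
  · intro φ
    rw [hd, ← counit_convOperator φ b]
    simp [f, L]
  · intro φ ψ
    rw [hd, hd, hd, ← LinearMap.toMatrix_mul]
    congr 1
    ext x
    simp [L, convOperator_conv]
  · rw [hd, ← LinearMap.toMatrix_one e]
    congr 1
    ext x
    simp [L, convOperator_counit]

theorem map_convPow {n : ℕ} {d : Matrix (Fin n) (Fin n) H}
    (hmul : ∀ φ ψ : H →ₗ[ℂ] ℂ, d.map (conv φ ψ) = d.map φ * d.map ψ)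
    (hone : d.map (Coalgebra.counit (R := ℂ) : H →ₗ[ℂ] ℂ) = 1) (ψ : H →ₗ[ℂ] ℂ) (k : ℕ) :
    d.map (convPow ψ k) = d.map ψ ^ k := by
  induction k with
  | zero => rw [pow_zero, ← hone]; rfl
  | succ k ih => rw [pow_succ, ← ih, ← hmul]; rfl

end MatrixCoefficients

section Generator

open Filter Topology

variable {H : Type*} [Ring H] [Bialgebra ℂ H] {φ : ℝ → (H →ₗ[ℂ] ℂ)}

attribute [local instance] Matrix.linftyOpNormedRing Matrix.linftyOpNormedAlgebra in
/-- Evaluating a weakly continuous convolution semigroup on a matrix corepresentation gives a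
matrix semigroup, described by a matrix generator. -/
theorem exists_matrix_generator {n : ℕ} {d : Matrix (Fin n) (Fin n) H}
    (hmul : ∀ φ ψ : H →ₗ[ℂ] ℂ, d.map (conv φ ψ) = d.map φ * d.map ψ)
    (hone : d.map (Coalgebra.counit (R := ℂ) : H →ₗ[ℂ] ℂ) = 1)
    (hsemigroup : ∀ s t : ℝ, 0 ≤ s → 0 ≤ t → φ (s + t) = conv (φ s) (φ t))
    (hzero : φ 0 = Coalgebra.counit (R := ℂ))
    (hcont : ∀ b : H, Tendsto (fun t : ℝ => φ t b) (𝓝[>] 0) (𝓝 (Coalgebra.counit (R := ℂ) b))) :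
    ∃ X : Matrix (Fin n) (Fin n) ℂ, ∀ f : Matrix (Fin n) (Fin n) ℂ →ₗ[ℂ] ℂ,
      Tendsto (fun t : ℝ =>
        (f (d.map (φ t)) - f (d.map (Coalgebra.counit (R := ℂ) : H →ₗ[ℂ] ℂ))) / (t : ℂ))
        (𝓝[>] 0) (𝓝 (f X)) ∧
      ∀ t : ℝ, 0 ≤ t → HasSum
        (fun k : ℕ => (((t ^ k : ℝ) : ℂ) / (k.factorial : ℂ)) * f (X ^ k)) (f (d.map (φ t))) := by
  have hT0 : d.map (φ 0) = 1 := by rw [hzero, hone]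
  have hT : Tendsto (fun t => d.map (φ t)) (𝓝[>] 0) (𝓝 1) := by
    rw [← hone]
    exact tendsto_pi_nhds.2 fun i => tendsto_pi_nhds.2 fun j => hcont (d i j)
  obtain ⟨X, hX⟩ := exists_eq_exp_smul_of_semigroup (T := fun t => d.map (φ t)) hT0
    (fun s t hs ht => by rw [hsemigroup s t hs ht, hmul]) hT
  refine ⟨X, fun f => ?_⟩
  have hf : Continuous f := LinearMap.continuous_of_finiteDimensional f
  constructor
  · have hderiv := (hasDerivAt_exp_smul_const' X (0 : ℝ)).tendsto_slope_zero_right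
    rw [zero_smul, NormedSpace.exp_zero, mul_one] at hderiv
    refine ((hf.tendsto X).comp hderiv).congr' ?_
    filter_upwards [self_mem_nhdsWithin] with t ht
    simp only [Function.comp_apply, zero_add, hone, hX t (le_of_lt ht)]
    rw [← map_sub, ← Complex.coe_smul, map_smul, smul_eq_mul, Complex.ofReal_inv, div_eq_inv_mul]
  · intro t ht
    have hsum := (NormedSpace.exp_series_hasSum_exp' (𝕂 := ℂ) (t • X)).map f hf
    rw [hX t ht]
    refine hsum.congr_fun fun k => ?_
    rw [Function.comp_apply, smul_pow, ← Complex.coe_smul, smul_smul, map_smul, smul_eq_mul,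
      div_eq_inv_mul]

/-- The generator of a weakly continuous convolution semigroup of linear functionals exists, and
the semigroup is its convolution exponential. -/
theorem exists_generator
    (hsemigroup : ∀ s t : ℝ, 0 ≤ s → 0 ≤ t → φ (s + t) = conv (φ s) (φ t))
    (hzero : φ 0 = Coalgebra.counit (R := ℂ))
    (hcont : ∀ b : H, Tendsto (fun t : ℝ => φ t b) (𝓝[>] 0) (𝓝 (Coalgebra.counit (R := ℂ) b))) :
    ∃ ψ : H →ₗ[ℂ] ℂ,
      (∀ b : H, Tendsto (fun t : ℝ => (φ t b - Coalgebra.counit (R := ℂ) b) / (t : ℂ))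
        (𝓝[>] 0) (𝓝 (ψ b))) ∧
      ∀ t : ℝ, 0 ≤ t → ∀ b : H, HasSum
        (fun k : ℕ => (((t ^ k : ℝ) : ℂ) / (k.factorial : ℂ)) * convPow ψ k b) (φ t b) := by
  have hlim : ∀ b : H, ∃ c : ℂ,
      Tendsto (fun t : ℝ => (φ t b - Coalgebra.counit (R := ℂ) b) / (t : ℂ)) (𝓝[>] 0) (𝓝 c) := by
    intro b
    obtain ⟨n, d, f, hf, hmul, hone⟩ := exists_matrix_corepresentation b
    obtain ⟨X, hX⟩ := exists_matrix_generator hmul hone hsemigroup hzero hcont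
    refine ⟨f X, ?_⟩
    simpa only [hf] using (hX f).1
  choose g hg using hlim
  let ψ : H →ₗ[ℂ] ℂ :=
    { toFun := g
      map_add' := fun x y => tendsto_nhds_unique (hg (x + y)) <|
        ((hg x).add (hg y)).congr fun t => by rw [map_add, map_add]; ring
      map_smul' := fun c x => tendsto_nhds_unique (hg (c • x)) <|
        ((hg x).const_mul c).congr fun t => by
          rw [map_smul, map_smul, smul_eq_mul, smul_eq_mul]; ring }
  refine ⟨ψ, hg, fun t ht b => ?_⟩
  obtain ⟨n, d, f, hf, hmul, hone⟩ := exists_matrix_corepresentation b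
  obtain ⟨X, hX⟩ := exists_matrix_generator hmul hone hsemigroup hzero hcont
  have hXψ : X = d.map ψ := by
    ext i j
    exact tendsto_nhds_unique (hX (Matrix.entryLinearMap ℂ ℂ i j)).1 (hg (d i j))
  have hsum := (hX f).2 t ht
  simpa only [hXψ, ← map_convPow hmul hone, ← hf] using hsum

end Generator

section Hermitian

open ComplexConjugate

variable {A : Type*} [Ring A] [StarRing A] [Algebra ℂ A] [StarModule ℂ A]

/-- A linear functional that is nonnegative on all `star b * b` is hermitian. -/
theorem apply_star_of_nonneg {φ : A →ₗ[ℂ] ℂ} (hφ : ∀ b : A, 0 ≤ φ (star b * b)) (b : A) :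
    φ (star b) = conj (φ b) := by
  have him : ∀ b : A, (φ (star b * b)).im = 0 := fun b => (Complex.nonneg_iff.1 (hφ b)).2.symm
  have h1 := him (1 + b)
  have h2 := him (1 + Complex.I • b)
  have h3 := him 1
  have h4 := him b
  simp [add_mul, mul_add, smul_smul] at h1 h2 h3
  apply Complex.ext <;> simp <;> linarith

end Hermitian

/-- Let B be a *-bialgebra (the compatibility of Δ and δ with the involution is
expressed by `hΔstar` and `hδstar`) and let (φ_t)_{t≥0} be a weakly continuous
convolution semigroup of states on B.  Then ψ(b) = lim_{t↓0} (φ_t(b) − δ(b))/t exists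
for every b; ψ is hermitian, conditionally positive and ψ(1) = 0; and
φ_t = exp_⋆(tψ) for all t ≥ 0. -/
theorem convolution_semigroup_of_states_has_generator
    (hΔstar : ∀ (b : B) (n : ℕ) (b₁ b₂ : Fin n → B),
      Coalgebra.comul (R := ℂ) b = ∑ i, b₁ i ⊗ₜ[ℂ] b₂ i →
      Coalgebra.comul (R := ℂ) (star b) = ∑ i, star (b₁ i) ⊗ₜ[ℂ] star (b₂ i))
    (hδstar : ∀ b : B,
      Coalgebra.counit (R := ℂ) (star b) = (starRingEnd ℂ) (Coalgebra.counit (R := ℂ) b))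
    (φ : ℝ → (B →ₗ[ℂ] ℂ))
    (hstate : ∀ t : ℝ, 0 ≤ t → (φ t 1 = 1 ∧ ∀ b : B, 0 ≤ φ t (star b * b)))
    (hsemigroup : ∀ s t : ℝ, 0 ≤ s → 0 ≤ t → φ (s + t) = conv (φ s) (φ t))
    (hzero : φ 0 = Coalgebra.counit (R := ℂ))
    (hcont : ∀ b : B, Filter.Tendsto (fun t : ℝ => φ t b)
      (nhdsWithin 0 (Set.Ioi 0)) (nhds (Coalgebra.counit (R := ℂ) b))) :
    ∃ ψ : B →ₗ[ℂ] ℂ,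
      (∀ b : B, Filter.Tendsto
          (fun t : ℝ => (φ t b - Coalgebra.counit (R := ℂ) b) / (t : ℂ))
          (nhdsWithin 0 (Set.Ioi 0)) (nhds (ψ b))) ∧
      (∀ b : B, ψ (star b) = (starRingEnd ℂ) (ψ b)) ∧
      (∀ b : B, Coalgebra.counit (R := ℂ) b = 0 → 0 ≤ ψ (star b * b)) ∧
      ψ 1 = 0 ∧
      ∀ t : ℝ, 0 ≤ t → ∀ b : B, HasSum
        (fun k : ℕ => (((t ^ k : ℝ) : ℂ) / (k.factorial : ℂ)) * convPow ψ k b)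
        (φ t b) := by
  obtain ⟨ψ, hψ, hexp⟩ := exists_generator hsemigroup hzero hcont
  refine ⟨ψ, hψ, fun b => ?_, fun b hb => ?_, ?_, hexp⟩
  · refine tendsto_nhds_unique (hψ (star b))
      (((Complex.continuous_conj.tendsto _).comp (hψ b)).congr' ?_)
    filter_upwards [self_mem_nhdsWithin] with t ht
    rw [Function.comp_apply, map_div₀, map_sub, Complex.conj_ofReal, hδstar,
      apply_star_of_nonneg (hstate t (le_of_lt ht)).2]
  · refine ge_of_tendsto (hψ (star b * b)) ?_
    filter_upwards [self_mem_nhdsWithin] with t ht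
    rw [Bialgebra.counit_mul, hb, mul_zero, sub_zero, div_eq_mul_inv, ← Complex.ofReal_inv]
    exact mul_nonneg ((hstate t (le_of_lt ht)).2 b)
      (Complex.zero_le_real.2 (inv_nonneg.2 (le_of_lt ht)))
  · refine tendsto_nhds_unique (hψ 1) (tendsto_const_nhds.congr' ?_)
    filter_upwards [self_mem_nhdsWithin] with t ht
    rw [(hstate t (le_of_lt ht)).1, Bialgebra.counit_one, sub_self, zero_div]

end
end
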